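/- Let G be a finite group and let α and β be actions of G on unital C*-algebras A and B, respectively. Suppose α and β are strongly Morita equivalent with respect to an action λ of G on an A-B-equivalence bimodule X. Let C = A ⋊_α G, D = B ⋊_β G, and let X ⋊_λ G be the crossed product bimodule, with X_t = X w_t for t ∈ G, where elements of X ⋊_λ G are formal sums Σ_{t∈G} x_t w_t. Define the left C-action, right D-action and inner products by (a u_t)·(x w_s) = (a·λ_t(x)) w_{ts}, (x w_s)·(b v_t) = (x·β_s(b)) v_{st}, ⟨x w_t, y w_s⟩_C = ⟨x, λ_{ts⁻¹}(y)⟩_A u_{ts⁻¹}, and ⟨x w_t, y w_s⟩_D = β_{t⁻¹}(⟨x, y⟩_B) v_{t⁻¹s}. Then X_λ = {X_t}_{t∈G} is an A_α-A_β-equivalence bundle satisfying ⟨X_t, X_s⟩_C = A_{ts⁻¹} and ⟨X_t, X_s⟩_D = B_{t⁻¹s} for all t, s ∈ G, where A_α = {A u_t}_{t∈G} and A_β = {B v_t}_{t∈G} are the C*-algebraic bundles over G induced by α and β. -/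

import Mathlib

noncomputable section

open scoped BigOperators

/-- The data and axioms of a Hilbert `C`-`D`-bimodule in the sense of
Brown–Mingo–Shen: a bimodule over the C*-algebras `C` and `D` carrying a
left `C`-valued and a right `D`-valued inner product, compatible with the
module actions and satisfying the associativity relation
`⟨x, y⟩_C • z = x • ⟨y, z⟩_D`. -/
structure HilbertBimod (C : Type*) (D : Type*) (Y : Type*)
    [NormedRing C] [StarRing C] [NormedRing D] [StarRing D]
    [NormedAddCommGroup Y] where
  lsmul : C → Y → Y
  rsmul : Y → D → Y
  linner : Y → Y → C
  rinner : Y → Y → D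
  lsmul_add : ∀ c x y, lsmul c (x + y) = lsmul c x + lsmul c y
  add_lsmul : ∀ c c' x, lsmul (c + c') x = lsmul c x + lsmul c' x
  mul_lsmul : ∀ c c' x, lsmul (c * c') x = lsmul c (lsmul c' x)
  one_lsmul : ∀ x, lsmul 1 x = x
  rsmul_add : ∀ x y d, rsmul (x + y) d = rsmul x d + rsmul y d
  add_rsmul : ∀ x d d', rsmul x (d + d') = rsmul x d + rsmul x d'
  rsmul_mul : ∀ x d d', rsmul x (d * d') = rsmul (rsmul x d) d'
  rsmul_one : ∀ x, rsmul x 1 = x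
  lsmul_rsmul : ∀ c x d, rsmul (lsmul c x) d = lsmul c (rsmul x d)
  linner_add_left : ∀ x y z, linner (x + y) z = linner x z + linner y z
  linner_add_right : ∀ x y z, linner x (y + z) = linner x y + linner x z
  linner_lsmul_left : ∀ c x y, linner (lsmul c x) y = c * linner x y
  linner_star : ∀ x y, star (linner x y) = linner y x
  rinner_add_left : ∀ x y z, rinner (x + y) z = rinner x z + rinner y z
  rinner_add_right : ∀ x y z, rinner x (y + z) = rinner x y + rinner x z
  rinner_rsmul_right : ∀ x y d, rinner x (rsmul y d) = rinner x y * d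
  rinner_star : ∀ x y, star (rinner x y) = rinner y x
  inner_assoc : ∀ x y z, lsmul (linner x y) z = rsmul x (rinner y z)
  norm_linner_self : ∀ x, ‖linner x x‖ = ‖x‖ ^ 2
  norm_rinner_self : ∀ x, ‖rinner x x‖ = ‖x‖ ^ 2

/-- Fullness of the left inner product: the closed linear span of the left
inner products is all of `C`. -/
def HilbertBimod.LFull {C D Y : Type*} [NormedRing C] [StarRing C] [NormedAlgebra ℂ C]
    [NormedRing D] [StarRing D] [NormedAddCommGroup Y]
    (E : HilbertBimod C D Y) : Prop :=
  (Submodule.span ℂ {c : C | ∃ x y : Y, c = E.linner x y}).topologicalClosure = ⊤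

/-- Fullness of the right inner product. -/
def HilbertBimod.RFull {C D Y : Type*} [NormedRing C] [StarRing C]
    [NormedRing D] [StarRing D] [NormedAlgebra ℂ D] [NormedAddCommGroup Y]
    (E : HilbertBimod C D Y) : Prop :=
  (Submodule.span ℂ {d : D | ∃ x y : Y, d = E.rinner x y}).topologicalClosure = ⊤

/-- A C*-algebraic bundle over a group `G`, presented through the grading it
induces on the C*-algebra `C = ⊕_{t ∈ G} A_t` of its sections:  a family of
closed subspaces `A_t ⊆ C` with `A_t A_s ⊆ A_{ts}`, `A_t* = A_{t⁻¹}`, whose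
internal direct sum is all of `C`. -/
structure CStarBundle (G : Type*) [Group G] [DecidableEq G] (C : Type*)
    [NormedRing C] [StarRing C] [NormedAlgebra ℂ C] where
  fiber : G → Submodule ℂ C
  fiber_closed : ∀ t, IsClosed (fiber t : Set C)
  mul_mem : ∀ {t s : G} {x y : C}, x ∈ fiber t → y ∈ fiber s → x * y ∈ fiber (t * s)
  star_mem : ∀ {t : G} {x : C}, x ∈ fiber t → star x ∈ fiber t⁻¹
  isInternal : DirectSum.IsInternal fiber

/-- A C*-algebraic bundle is saturated if the closed span of `A_t A_t*` is
`A_e` for every `t`. -/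
def CStarBundle.Saturated {G : Type*} [Group G] [DecidableEq G] {C : Type*}
    [NormedRing C] [StarRing C] [NormedAlgebra ℂ C] (𝒜 : CStarBundle G C) : Prop :=
  ∀ t, (Submodule.span ℂ
      {x : C | ∃ a ∈ 𝒜.fiber t, ∃ b ∈ 𝒜.fiber t, x = a * star b}).topologicalClosure
    = 𝒜.fiber 1

/-- The data of an equivalence bundle in the sense of Abadie–Ferraro between
two C*-algebraic bundles with fibers `Afib` (inside `C`) and `Bfib` (inside
`D`):  a grading `{X_t}_{t ∈ G}` of the `C`-`D`-bimodule `Y = ⊕_{t∈G} X_t`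
which is compatible with the two bundle gradings (conditions (1R)-(7R) and
(1L)-(7L) of Abadie–Ferraro). -/
structure EquivBundleData {G : Type*} [Group G] [DecidableEq G] {C D Y : Type*}
    [NormedRing C] [StarRing C] [NormedAlgebra ℂ C]
    [NormedRing D] [StarRing D] [NormedAlgebra ℂ D]
    [NormedAddCommGroup Y]
    (Afib : G → Submodule ℂ C) (Bfib : G → Submodule ℂ D)
    (E : HilbertBimod C D Y) where
  fiber : G → AddSubgroup Y
  fiber_closed : ∀ t, IsClosed (fiber t : Set Y)
  isInternal : DirectSum.IsInternal fiber
  lsmul_mem : ∀ {t s : G} {c : C} {x : Y}, c ∈ Afib t → x ∈ fiber s →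
    E.lsmul c x ∈ fiber (t * s)
  rsmul_mem : ∀ {t s : G} {x : Y} {d : D}, x ∈ fiber t → d ∈ Bfib s →
    E.rsmul x d ∈ fiber (t * s)
  linner_mem : ∀ {t s : G} {x y : Y}, x ∈ fiber t → y ∈ fiber s →
    E.linner x y ∈ Afib (t * s⁻¹)
  rinner_mem : ∀ {t s : G} {x y : Y}, x ∈ fiber t → y ∈ fiber s →
    E.rinner x y ∈ Bfib (t⁻¹ * s)

/-- The strengthened fullness conditions `⟨X_t , X_s⟩_C = A_{ts⁻¹}` and
`⟨X_t , X_s⟩_D = B_{t⁻¹s}` for an equivalence bundle. -/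
def EquivBundleData.StrictSpan {G : Type*} [Group G] [DecidableEq G] {C D Y : Type*}
    [NormedRing C] [StarRing C] [NormedAlgebra ℂ C]
    [NormedRing D] [StarRing D] [NormedAlgebra ℂ D]
    [NormedAddCommGroup Y]
    {Afib : G → Submodule ℂ C} {Bfib : G → Submodule ℂ D}
    {E : HilbertBimod C D Y} (Z : EquivBundleData Afib Bfib E) : Prop :=
  (∀ t s : G, Submodule.span ℂ
      {c : C | ∃ x ∈ Z.fiber t, ∃ y ∈ Z.fiber s, c = E.linner x y} = Afib (t * s⁻¹)) ∧
  (∀ t s : G, Submodule.span ℂ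
      {d : D | ∃ x ∈ Z.fiber t, ∃ y ∈ Z.fiber s, d = E.rinner x y} = Bfib (t⁻¹ * s))

/-- A witness of strong Morita equivalence of the unital inclusions
`A ⊆ C` and `B ⊆ D`:  a `C`-`D`-equivalence bimodule `Y` together with a
closed subspace `X₀ ⊆ Y` which is an `A`-`B`-equivalence bimodule and such
that `⟨Y , X₀⟩_C` is dense in `C` and `⟨Y , X₀⟩_D` is dense in `D`. -/
structure MoritaIncl (C D : Type*)
    [NormedRing C] [StarRing C] [NormedAlgebra ℂ C]
    [NormedRing D] [StarRing D] [NormedAlgebra ℂ D]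
    (A : Submodule ℂ C) (B : Submodule ℂ D) where
  Y : Type
  [instN : NormedAddCommGroup Y]
  [instC : CompleteSpace Y]
  E : HilbertBimod C D Y
  lFull : E.LFull
  rFull : E.RFull
  X₀ : AddSubgroup Y
  closed_X₀ : IsClosed (X₀ : Set Y)
  lsmul_mem : ∀ {a : C} {x : Y}, a ∈ A → x ∈ X₀ → E.lsmul a x ∈ X₀
  rsmul_mem : ∀ {x : Y} {b : D}, x ∈ X₀ → b ∈ B → E.rsmul x b ∈ X₀
  linner_mem : ∀ {x y : Y}, x ∈ X₀ → y ∈ X₀ → E.linner x y ∈ A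
  rinner_mem : ∀ {x y : Y}, x ∈ X₀ → y ∈ X₀ → E.rinner x y ∈ B
  linner_full : (Submodule.span ℂ
      {c : C | ∃ x ∈ X₀, ∃ y ∈ X₀, c = E.linner x y}).topologicalClosure = A
  rinner_full : (Submodule.span ℂ
      {d : D | ∃ x ∈ X₀, ∃ y ∈ X₀, d = E.rinner x y}).topologicalClosure = B
  linner_span : (Submodule.span ℂ
      {c : C | ∃ y : Y, ∃ x ∈ X₀, c = E.linner y x}).topologicalClosure = ⊤
  rinner_span : (Submodule.span ℂ
      {d : D | ∃ y : Y, ∃ x ∈ X₀, d = E.rinner y x}).topologicalClosure = ⊤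

/-- Strong Morita equivalence of the unital inclusions `A ⊆ C` and `B ⊆ D`. -/
def StronglyMoritaEquivalentIncl (C D : Type*)
    [NormedRing C] [StarRing C] [NormedAlgebra ℂ C]
    [NormedRing D] [StarRing D] [NormedAlgebra ℂ D]
    (A : Submodule ℂ C) (B : Submodule ℂ D) : Prop :=
  Nonempty (MoritaIncl C D A B)

/-- Right multiplication `x ↦ x · d` on a Hilbert bimodule, as an additive map. -/
def HilbertBimod.rsmulHom {C D Y : Type*} [NormedRing C] [StarRing C]
    [NormedRing D] [StarRing D] [NormedAddCommGroup Y]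
    (E : HilbertBimod C D Y) (d : D) : Y →+ Y :=
  AddMonoidHom.mk' (fun x => E.rsmul x d) (fun a b => E.rsmul_add a b d)

section NormedAlgebra

variable {C : Type*} [NormedRing C] [NormedAlgebra ℂ C] [CompleteSpace C]

/-- A dense subspace of a closed unital subalgebra contains an element which is invertible in that
subalgebra. -/
theorem Submodule.exists_mem_invertible_of_topologicalClosure_eq {A S : Submodule ℂ C}
    (hA1 : (1 : C) ∈ A) (hAmul : ∀ {a b : C}, a ∈ A → b ∈ A → a * b ∈ A)
    (hS : S.topologicalClosure = A) :
    ∃ s ∈ S, ∃ a ∈ A, a * s = 1 ∧ s * a = 1 := by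
  have hAclosed : IsClosed (A : Set C) := hS ▸ S.isClosed_topologicalClosure
  have h1 : (1 : C) ∈ closure (S : Set C) := by
    rw [← Submodule.topologicalClosure_coe, hS]
    exact hA1
  obtain ⟨s, hs, hdist⟩ := Metric.mem_closure_iff.mp h1 1 one_pos
  rw [dist_eq_norm] at hdist
  have hsA : s ∈ A := hS ▸ S.le_topologicalClosure hs
  have hpow : ∀ n : ℕ, (1 - s) ^ n ∈ A := by
    intro n
    induction n with
    | zero => simpa using hA1
    | succ n ih =>
      rw [pow_succ]
      exact hAmul ih (A.sub_mem hA1 hsA)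
  have hsum : Summable fun n : ℕ => (1 - s) ^ n :=
    summable_geometric_of_norm_lt_one hdist
  refine ⟨s, hs, ∑' n : ℕ, (1 - s) ^ n, ?_, ?_, ?_⟩
  · exact hAclosed.mem_of_tendsto hsum.hasSum
      (Filter.Eventually.of_forall fun F => A.sum_mem fun n _ => hpow n)
  · simpa using geom_series_mul_neg (1 - s) hdist
  · simpa using mul_neg_geom_series (1 - s) hdist

theorem Submodule.eq_of_topologicalClosure_eq_of_mul_mem_left {A S : Submodule ℂ C}
    (hA1 : (1 : C) ∈ A) (hAmul : ∀ {a b : C}, a ∈ A → b ∈ A → a * b ∈ A)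
    (hS : S.topologicalClosure = A) (hideal : ∀ a ∈ A, ∀ s ∈ S, a * s ∈ S) : S = A := by
  obtain ⟨s, hs, a, ha, has, -⟩ :=
    Submodule.exists_mem_invertible_of_topologicalClosure_eq hA1 hAmul hS
  refine le_antisymm (hS ▸ S.le_topologicalClosure) fun b hb => ?_
  simpa [mul_assoc, has] using hideal (b * a) (hAmul hb ha) s hs

theorem Submodule.eq_of_topologicalClosure_eq_of_mul_mem_right {A S : Submodule ℂ C}
    (hA1 : (1 : C) ∈ A) (hAmul : ∀ {a b : C}, a ∈ A → b ∈ A → a * b ∈ A)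
    (hS : S.topologicalClosure = A) (hideal : ∀ a ∈ A, ∀ s ∈ S, s * a ∈ S) : S = A := by
  obtain ⟨s, hs, a, ha, -, hsa⟩ :=
    Submodule.exists_mem_invertible_of_topologicalClosure_eq hA1 hAmul hS
  refine le_antisymm (hS ▸ S.le_topologicalClosure) fun b hb => ?_
  simpa [← mul_assoc, hsa] using hideal (a * b) (hAmul ha hb) s hs

end NormedAlgebra

namespace HilbertBimod

variable {C D Y : Type*} [NormedRing C] [StarRing C] [NormedRing D] [StarRing D]
  [NormedAddCommGroup Y] (E : HilbertBimod C D Y)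

theorem linner_lsmul_right (x y : Y) (c : C) :
    E.linner x (E.lsmul c y) = E.linner x y * star c := by
  rw [← E.linner_star, E.linner_lsmul_left, star_mul, E.linner_star]

theorem rinner_rsmul_left (x y : Y) (d : D) :
    E.rinner (E.rsmul x d) y = star d * E.rinner x y := by
  rw [← E.rinner_star, E.rinner_rsmul_right, star_mul, E.rinner_star]

theorem linner_rsmul_left [CStarRing C] (x y : Y) (d : D) :
    E.linner (E.rsmul x d) y = E.linner x (E.rsmul y (star d)) := by
  have hact : ∀ z, E.lsmul (E.linner (E.rsmul x d) y) z =
      E.lsmul (E.linner x (E.rsmul y (star d))) z := fun z => by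
    rw [E.inner_assoc, E.inner_assoc, E.rinner_rsmul_left, star_star, E.rsmul_mul]
  have hmul : ∀ z w, E.linner (E.rsmul x d) y * E.linner z w =
      E.linner x (E.rsmul y (star d)) * E.linner z w := fun z w => by
    rw [← E.linner_lsmul_left, hact, E.linner_lsmul_left]
  rw [← sub_eq_zero, ← CStarRing.mul_star_self_eq_zero_iff, star_sub, E.linner_star,
    E.linner_star, mul_sub, sub_mul, sub_mul, hmul, hmul, sub_self, sub_self,
    sub_self]

theorem norm_rsmul_of_mul_star_eq_one [CStarRing C] {d : D} (hd : d * star d = 1) (x : Y) :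
    ‖E.rsmul x d‖ = ‖x‖ := by
  rw [← sq_eq_sq₀ (norm_nonneg _) (norm_nonneg _), ← E.norm_linner_self, E.linner_rsmul_left,
    ← E.rsmul_mul, hd, E.rsmul_one, E.norm_linner_self]

theorem isometry_rsmulHom [CStarRing C] {d : D} (hd : d * star d = 1) :
    Isometry (E.rsmulHom d) :=
  AddMonoidHomClass.isometry_of_norm _ (E.norm_rsmul_of_mul_star_eq_one hd)

end HilbertBimod

/-- Example 2.3 of the paper.
Let `α`, `β` be actions of a finite group `G` on unital C*-algebras `A`, `B`,
implemented by unitaries `u_t ∈ C = A ⋊_α G` and `v_t ∈ D = B ⋊_β G`, and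
suppose `α` and `β` are strongly Morita equivalent with respect to an action
`λ` of `G` on an `A`-`B`-equivalence bimodule `X` (so that
`λ_t(x) = u_t · x · v_{t⁻¹}` inside the crossed product bimodule
`Y = X ⋊_λ G`).  Then, with `X_t := X · v_t`, the family `{X_t}_{t∈G}` is an
`𝒜_α`-`𝒜_β`-equivalence bundle satisfying `⟨X_t , X_s⟩_C = A u_{ts⁻¹}` and
`⟨X_t , X_s⟩_D = B v_{t⁻¹s}` for all `t, s ∈ G`, where `𝒜_α = {A u_t}_{t∈G}`
and `𝒜_β = {B v_t}_{t∈G}` are the C*-algebraic bundles induced by `α`, `β`. -/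
theorem crossed_product_equivalence_bundle
    {G : Type} [Group G] [Fintype G] [DecidableEq G]
    {C D : Type} [CStarAlgebra C] [CStarAlgebra D]
    (A : Submodule ℂ C) (B : Submodule ℂ D)
    (hAclosed : IsClosed (A : Set C)) (hBclosed : IsClosed (B : Set D))
    (hA1 : (1 : C) ∈ A) (hB1 : (1 : D) ∈ B)
    (hAmul : ∀ {a b : C}, a ∈ A → b ∈ A → a * b ∈ A)
    (hBmul : ∀ {a b : D}, a ∈ B → b ∈ B → a * b ∈ B)
    (hAstar : ∀ {a : C}, a ∈ A → star a ∈ A)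
    (hBstar : ∀ {a : D}, a ∈ B → star a ∈ B)
    -- the implementing unitaries of `α` and `β`:
    (u : G → C) (v : G → D)
    (hu1 : u 1 = 1) (humul : ∀ t s, u t * u s = u (t * s))
    (hustar : ∀ t, star (u t) = u t⁻¹) (huunit : ∀ t, u t * star (u t) = 1)
    (hv1 : v 1 = 1) (hvmul : ∀ t s, v t * v s = v (t * s))
    (hvstar : ∀ t, star (v t) = v t⁻¹) (hvunit : ∀ t, v t * star (v t) = 1)
    -- `α_t = Ad(u_t)` and `β_t = Ad(v_t)` are actions on `A` resp. `B`:
    (hαA : ∀ t, ∀ a ∈ A, u t * a * star (u t) ∈ A)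
    (hβB : ∀ t, ∀ b ∈ B, v t * b * star (v t) ∈ B)
    -- the crossed product decompositions `C = ⊕_t A u_t` and `D = ⊕_t B v_t`:
    (hCint : DirectSum.IsInternal fun t => Submodule.map (LinearMap.mulRight ℂ (u t)) A)
    (hDint : DirectSum.IsInternal fun t => Submodule.map (LinearMap.mulRight ℂ (v t)) B)
    -- the `A`-`B`-equivalence bimodule `X`, sitting inside `Y = X ⋊_λ G` as `X w_e`:
    {Y : Type} [NormedAddCommGroup Y] [CompleteSpace Y]
    (E : HilbertBimod C D Y)
    (X₀ : AddSubgroup Y) (hX₀closed : IsClosed (X₀ : Set Y))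
    (hlsmul : ∀ {a : C} {x : Y}, a ∈ A → x ∈ X₀ → E.lsmul a x ∈ X₀)
    (hrsmul : ∀ {x : Y} {b : D}, x ∈ X₀ → b ∈ B → E.rsmul x b ∈ X₀)
    (hlinner : ∀ {x y : Y}, x ∈ X₀ → y ∈ X₀ → E.linner x y ∈ A)
    (hrinner : ∀ {x y : Y}, x ∈ X₀ → y ∈ X₀ → E.rinner x y ∈ B)
    (hlfull : (Submodule.span ℂ
      {c : C | ∃ x ∈ X₀, ∃ y ∈ X₀, c = E.linner x y}).topologicalClosure = A)
    (hrfull : (Submodule.span ℂ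
      {d : D | ∃ x ∈ X₀, ∃ y ∈ X₀, d = E.rinner x y}).topologicalClosure = B)
    -- the action `λ_t = u_t · ( - ) · v_{t⁻¹}` of `G` preserves `X = X w_e`:
    (hlam : ∀ t, ∀ x ∈ X₀, E.lsmul (u t) (E.rsmul x (v t⁻¹)) ∈ X₀)
    -- `Y = ⊕_t X_t` with `X_t = X w_t = X · v_t`:
    (hYint : DirectSum.IsInternal fun t => X₀.map (E.rsmulHom (v t))) :
    E.LFull ∧ E.RFull ∧
    ∃ Z : EquivBundleData
        (fun t => Submodule.map (LinearMap.mulRight ℂ (u t)) A)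
        (fun t => Submodule.map (LinearMap.mulRight ℂ (v t)) B) E,
      (∀ t, Z.fiber t = X₀.map (E.rsmulHom (v t))) ∧ Z.StrictSpan := by
  have hustar' : ∀ t, star (u t⁻¹) = u t := fun t => by rw [hustar, inv_inv]
  have hu_inv : ∀ t, u t * u t⁻¹ = 1 := fun t => by rw [humul, mul_inv_cancel, hu1]
  have hv_inv : ∀ t, v t * v t⁻¹ = 1 := fun t => by rw [hvmul, mul_inv_cancel, hv1]
  have hv_inv' : ∀ t, v t⁻¹ * v t = 1 := fun t => by rw [hvmul, inv_mul_cancel, hv1]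
  have hu_inv' : ∀ t, u t⁻¹ * u t = 1 := fun t => by rw [humul, inv_mul_cancel, hu1]
  -- the covariance relation `u_t x = λ_t(x) v_t`
  have hcov : ∀ t, ∀ x, E.lsmul (u t) x =
      E.rsmul (E.lsmul (u t) (E.rsmul x (v t⁻¹))) (v t) := fun t x => by
    rw [E.lsmul_rsmul, ← E.rsmul_mul, hv_inv', E.rsmul_one]
  -- the left inner product formula, up to `λ`
  have hlform : ∀ t s x y, E.linner (E.rsmul x (v t)) (E.rsmul y (v s)) =
      E.linner x (E.lsmul (u (s * t⁻¹)⁻¹) (E.rsmul y (v (s * t⁻¹)⁻¹⁻¹))) * u (t * s⁻¹) := by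
    intro t s x y
    have hr : t * s⁻¹ = (s * t⁻¹)⁻¹ := by group
    rw [hr, E.linner_lsmul_right, hustar', mul_assoc, hu_inv, mul_one, inv_inv,
      E.linner_rsmul_left, ← E.rsmul_mul, hvstar, hvmul]
  have hrform : ∀ t s x y, E.rinner (E.rsmul x (v t)) (E.rsmul y (v s)) =
      v t⁻¹ * E.rinner x y * v s := fun t s x y => by
    rw [E.rinner_rsmul_right, E.rinner_rsmul_left, hvstar]
  have hβB' : ∀ t, ∀ b ∈ B, v t⁻¹ * b * v t ∈ B := fun t b hb => by
    simpa [hvstar] using hβB t⁻¹ b hb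
  have hlspan : Submodule.span ℂ {c : C | ∃ x ∈ X₀, ∃ y ∈ X₀, c = E.linner x y} = A := by
    refine Submodule.eq_of_topologicalClosure_eq_of_mul_mem_left hA1 hAmul hlfull
      fun a ha s hs => ?_
    induction hs using Submodule.span_induction with
    | mem c hc =>
      obtain ⟨x, hx, y, hy, rfl⟩ := hc
      exact Submodule.subset_span
        ⟨E.lsmul a x, hlsmul ha hx, y, hy, (E.linner_lsmul_left a x y).symm⟩
    | zero => simp
    | add c d _ _ hc hd =>
      rw [mul_add]
      exact add_mem hc hd
    | smul k c _ hc =>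
      rw [mul_smul_comm]
      exact Submodule.smul_mem _ k hc
  have hrspan : Submodule.span ℂ {d : D | ∃ x ∈ X₀, ∃ y ∈ X₀, d = E.rinner x y} = B := by
    refine Submodule.eq_of_topologicalClosure_eq_of_mul_mem_right hB1 hBmul hrfull
      fun b hb s hs => ?_
    induction hs using Submodule.span_induction with
    | mem c hc =>
      obtain ⟨x, hx, y, hy, rfl⟩ := hc
      exact Submodule.subset_span
        ⟨x, hx, E.rsmul y b, hrsmul hy hb, (E.rinner_rsmul_right x y b).symm⟩
    | zero => simp
    | add c d _ _ hc hd =>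
      rw [add_mul]
      exact add_mem hc hd
    | smul k c _ hc =>
      rw [smul_mul_assoc]
      exact Submodule.smul_mem _ k hc
  let Z : EquivBundleData
      (fun t => Submodule.map (LinearMap.mulRight ℂ (u t)) A)
      (fun t => Submodule.map (LinearMap.mulRight ℂ (v t)) B) E :=
    { fiber := fun t => X₀.map (E.rsmulHom (v t))
      fiber_closed := fun t => by
        rw [AddSubgroup.coe_map]
        exact (E.isometry_rsmulHom (hvunit t)).isClosedEmbedding.isClosedMap _ hX₀closed
      isInternal := hYint
      lsmul_mem := by
        rintro t s _ _ ⟨a, ha, rfl⟩ ⟨x, hx, rfl⟩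
        refine ⟨_, hlsmul ha (hlam t x hx), ?_⟩
        change E.rsmul _ _ = E.lsmul (a * u t) (E.rsmul x (v s))
        rw [← hvmul, E.rsmul_mul, E.lsmul_rsmul a, ← hcov, ← E.mul_lsmul, E.lsmul_rsmul]
      rsmul_mem := by
        rintro t s _ _ ⟨x, hx, rfl⟩ ⟨b, hb, rfl⟩
        refine ⟨_, hrsmul hx (hβB t b hb), ?_⟩
        change E.rsmul _ _ = E.rsmul (E.rsmul x (v t)) (b * v s)
        rw [← E.rsmul_mul, ← E.rsmul_mul, ← hvmul, hvstar]
        congr 1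
        rw [mul_assoc _ (v t⁻¹), ← mul_assoc (v t⁻¹), hv_inv', one_mul, mul_assoc]
      linner_mem := by
        rintro t s _ _ ⟨x, hx, rfl⟩ ⟨y, hy, rfl⟩
        exact ⟨_, hlinner hx (hlam (s * t⁻¹)⁻¹ y hy), (hlform t s x y).symm⟩
      rinner_mem := by
        rintro t s _ _ ⟨x, hx, rfl⟩ ⟨y, hy, rfl⟩
        refine ⟨_, hβB' t _ (hrinner hx hy), ?_⟩
        change _ * v (t⁻¹ * s) = E.rinner (E.rsmul x (v t)) (E.rsmul y (v s))
        rw [hrform, ← hvmul, mul_assoc _ (v t), ← mul_assoc (v t), hv_inv, one_mul] }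
  have hZl : ∀ t s : G, Submodule.span ℂ
      {c : C | ∃ x ∈ Z.fiber t, ∃ y ∈ Z.fiber s, c = E.linner x y} =
        Submodule.map (LinearMap.mulRight ℂ (u (t * s⁻¹))) A := by
    intro t s
    refine le_antisymm (Submodule.span_le.mpr ?_) ?_
    · rintro _ ⟨x, hx, y, hy, rfl⟩
      exact Z.linner_mem hx hy
    · refine (Submodule.map_mono hlspan.ge).trans ((Submodule.map_span_le _ _ _).mpr ?_)
      rintro _ ⟨x, hx, y, hy, rfl⟩
      refine Submodule.subset_span ⟨_, ⟨x, hx, rfl⟩, _, ⟨_, hlam (s * t⁻¹) y hy, rfl⟩, ?_⟩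
      change E.linner x y * _ = E.linner (E.rsmul x (v t)) (E.rsmul _ (v s))
      rw [hlform, inv_inv, E.lsmul_rsmul, ← E.mul_lsmul, hu_inv', E.one_lsmul, ← E.rsmul_mul,
        hv_inv', E.rsmul_one]
  have hZr : ∀ t s : G, Submodule.span ℂ
      {d : D | ∃ x ∈ Z.fiber t, ∃ y ∈ Z.fiber s, d = E.rinner x y} =
        Submodule.map (LinearMap.mulRight ℂ (v (t⁻¹ * s))) B := by
    intro t s
    refine le_antisymm (Submodule.span_le.mpr ?_) ?_
    · rintro _ ⟨x, hx, y, hy, rfl⟩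
      exact Z.rinner_mem hx hy
    · rintro _ ⟨b, hb, rfl⟩
      have hmem : v t * b * star (v t) ∈ Submodule.span ℂ
          {d : D | ∃ x ∈ X₀, ∃ y ∈ X₀, d = E.rinner x y} := hrspan ▸ hβB t b hb
      have hle : Submodule.map (LinearMap.mulLeftRight ℂ (v t⁻¹, v s)) (Submodule.span ℂ
          {d : D | ∃ x ∈ X₀, ∃ y ∈ X₀, d = E.rinner x y}) ≤ Submodule.span ℂ
          {d : D | ∃ x ∈ Z.fiber t, ∃ y ∈ Z.fiber s, d = E.rinner x y} := by
        rw [Submodule.map_span_le]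
        rintro _ ⟨x, hx, y, hy, rfl⟩
        exact Submodule.subset_span
          ⟨_, ⟨x, hx, rfl⟩, _, ⟨y, hy, rfl⟩, (hrform t s x y).symm⟩
      convert hle (Submodule.mem_map_of_mem hmem) using 1
      rw [LinearMap.mulLeftRight_apply, LinearMap.mulRight_apply, ← hvmul, hvstar,
        ← mul_assoc, ← mul_assoc, ← mul_assoc, hv_inv', one_mul]
  refine ⟨?_, ?_, Z, fun _ => rfl, hZl, hZr⟩
  · refine top_le_iff.mp (le_trans ?_ (Submodule.le_topologicalClosure _))
    rw [← hCint.submodule_iSup_eq_top]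
    refine iSup_le fun t => ?_
    have h := hZl t 1
    rw [inv_one, mul_one] at h
    rw [← h]
    exact Submodule.span_mono fun _ ⟨x, _, y, _, hc⟩ => ⟨x, y, hc⟩
  · refine top_le_iff.mp (le_trans ?_ (Submodule.le_topologicalClosure _))
    rw [← hDint.submodule_iSup_eq_top]
    refine iSup_le fun t => ?_
    have h := hZr 1 t
    rw [inv_one, one_mul] at h
    rw [← h]
    exact Submodule.span_mono fun _ ⟨x, _, y, _, hc⟩ => ⟨x, y, hc⟩
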